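/- arXiv:2106.07816 — 3 statements merged into one kernel-verified Lean document; each statement's English description precedes it below -/
import Mathlib

section
/- Each set S_{l,j,s} = { φ : Gain_{R^(l−1)}(y'(φ,ν), j, s) ≤ Gain_{R^(l−1)}(y'(φ,ν), j_l, s_l) } is the solution set of a quadratic inequality in φ; explicitly, Gain_R(y'(φ,ν), j, s) = a(R,j,s)φ² + b(R,j,s)φ + c(R,j,s) where a(R,j,s) = ν^T M_{R,j,s} ν / ||ν||⁴_2, b(R,j,s) = 2 ν^T M_{R,j,s} P_ν^⊥ y / ||ν||²_2, and c(R,j,s) = y^T P_ν^⊥ M_{R,j,s} P_ν^⊥ y, so that S_{l,j,s} is the set of φ for which a quadratic polynomial in φ with these coefficient differences is ≤ 0. (Proposition 4 / Lemma C.2.) -/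
/-
Formalization of the selective inference framework for CART
("Tree-Values: selective inference for regression trees").

We set up the CART algorithm (growing via greedy gain maximization,
Algorithm 1, and cost-complexity pruning, Algorithm 2), contrast vectors,
conditioning sets, and the relevant conditional probabilities.

Conditioning on the measure-zero event `P_ν^⊥ Y = P_ν^⊥ y` is formalized
via the regular conditional distribution of `Y` given `P_ν^⊥ Y = P_ν^⊥ y`:
since `Y = P_ν^⊥ Y + (ν^T Y) ν / ‖ν‖²` with `ν^T Y ~ N(ν^T μ, σ²‖ν‖²)`
independent of `P_ν^⊥ Y`, this conditional distribution is the law of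
`φ ↦ y'(φ, ν)` where `φ ~ N(ν^T μ, σ²‖ν‖²)`.
-/

open MeasureTheory ProbabilityTheory
open scoped ENNReal NNReal Classical

noncomputable section

namespace TreeValues

variable {n p : ℕ}

/-- A region of covariate space `ℝ^p`. -/
abbrev Region (p : ℕ) := Set (Fin p → ℝ)

/-- The indices of the observations whose covariate vectors lie in region `R`. -/
def obs (X : Fin n → Fin p → ℝ) (R : Region p) : Finset (Fin n) :=
  Finset.univ.filter fun i => X i ∈ R

/-- The mean response `ȳ_R` over the observations in region `R`. -/
def regMean (X : Fin n → Fin p → ℝ) (y : Fin n → ℝ) (R : Region p) : ℝ :=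
  (∑ i ∈ obs X R, y i) / (obs X R).card

/-- The within-region sum of squared errors `Σ_{i : x_i ∈ R} (y_i - ȳ_R)²`. -/
def sse (X : Fin n → Fin p → ℝ) (y : Fin n → ℝ) (R : Region p) : ℝ :=
  ∑ i ∈ obs X R, (y i - regMean X y R) ^ 2

/-- The `s`-th order statistic (1-indexed) of the `j`-th covariate. -/
def orderStat (X : Fin n → Fin p → ℝ) (j : Fin p) (s : ℕ) : ℝ :=
  (List.insertionSort (· ≤ ·) ((List.finRange n).map fun i => X i j)).getD (s - 1) 0

/-- The halfspaces `χ_{j,s,1}` (`e = true`) and `χ_{j,s,0}` (`e = false`). -/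
def hsp (X : Fin n → Fin p → ℝ) (j : Fin p) (s : ℕ) (e : Bool) : Region p :=
  if e then {z | z j ≤ orderStat X j s} else {z | orderStat X j s < z j}

/-- The gain from splitting region `R` on covariate `j` at split point `s`. -/
def gain (X : Fin n → Fin p → ℝ) (y : Fin n → ℝ) (R : Region p) (j : Fin p) (s : ℕ) : ℝ :=
  sse X y R - (sse X y (R ∩ hsp X j s true) + sse X y (R ∩ hsp X j s false))

/-- The candidate splits `(j, s)`, `j ∈ {1,…,p}`, `s ∈ {1,…,n-1}`. -/
def splitSet (n p : ℕ) : Finset (Fin p × ℕ) := Finset.univ ×ˢ Finset.Icc 1 (n - 1)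

/-- `q` is a gain-maximizing split of `R`. -/
def IsBestSplit (X : Fin n → Fin p → ℝ) (y : Fin n → ℝ) (R : Region p) (q : Fin p × ℕ) : Prop :=
  q ∈ splitSet n p ∧ ∀ q' ∈ splitSet n p, gain X y R q'.1 q'.2 ≤ gain X y R q.1 q.2

/-- A gain-maximizing split (ties broken deterministically, depending only on the
gain profile, so that ties are broken in the same way for `y` and any perturbed response). -/
def bestSplit (X : Fin n → Fin p → ℝ) (y : Fin n → ℝ) (R : Region p) : Option (Fin p × ℕ) :=
  if h : ∃ q, IsBestSplit X y R q then some h.choose else none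

/-- A binary regression tree: each node is labeled by its region; an internal node
also records the split `(j, s)` that produced its children. -/
inductive RTree (p : ℕ) where
  | leaf : Region p → RTree p
  | node : Region p → Fin p × ℕ → RTree p → RTree p → RTree p

namespace RTree

variable {p : ℕ}

/-- The region at the root. -/
def root : RTree p → Region p
  | leaf R => R
  | node R _ _ _ => R

/-- The set of regions of the tree. -/
def regions : RTree p → Set (Region p)
  | leaf R => {R}
  | node R _ t1 t0 => insert R (t1.regions ∪ t0.regions)

/-- The terminal regions (leaves), as a list. -/
def leaves : RTree p → List (Region p)
  | leaf R => [R]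
  | node _ _ t1 t0 => t1.leaves ++ t0.leaves

/-- All regions of the tree, listed bottom-up. -/
def regionList : RTree p → List (Region p)
  | leaf R => [R]
  | node R _ t1 t0 => t1.regionList ++ t0.regionList ++ [R]

/-- `term(R, TREE)`: the terminal regions below the node with region `R`. -/
def leavesBelow : RTree p → Region p → List (Region p)
  | leaf R', R => if R' = R then [R'] else []
  | node R' q t1 t0, R =>
      if R' = R then (node R' q t1 t0).leaves
      else t1.leavesBelow R ++ t0.leavesBelow R

end RTree

/-- `g(R, TREE, y)`: the average per-region gain in sum of squared errors provided
by the descendants of `R` in the tree (equation (3) of the paper). -/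
def gOf (X : Fin n → Fin p → ℝ) (y : Fin n → ℝ) (t : RTree p) (R : Region p) : ℝ :=
  (sse X y R - ((t.leavesBelow R).map (sse X y)).sum) / (((t.leavesBelow R).length : ℝ) - 1)

/-- Algorithm 1 (growing), with fuel; a region is not split if no candidate split exists,
if the maximal gain is nonpositive, or if it contains at most one observation. -/
def grow (X : Fin n → Fin p → ℝ) (y : Fin n → ℝ) : ℕ → Region p → RTree p
  | 0, R => .leaf R
  | fuel + 1, R =>
    match bestSplit X y R with
    | none => .leaf R
    | some q =>
      if gain X y R q.1 q.2 ≤ 0 ∨ (obs X R).card ≤ 1 then .leaf R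
      else
        .node R q (grow X y fuel (R ∩ hsp X q.1 q.2 true))
          (grow X y fuel (R ∩ hsp X q.1 q.2 false))

/-- `TREE^0(y)`: the unpruned CART tree grown on the full covariate space. -/
def tree0 (X : Fin n → Fin p → ℝ) (y : Fin n → ℝ) : RTree p := grow X y n Set.univ

/-- Algorithm 2 (cost-complexity pruning), processing the regions bottom-up:
the descendants of `R` are removed when `g(R, TREE, y) < λ`. -/
def prune (X : Fin n → Fin p → ℝ) (y : Fin n → ℝ) (lam : ℝ) : RTree p → RTree p
  | .leaf R => .leaf R
  | .node R q t1 t0 =>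
    let t' := RTree.node R q (prune X y lam t1) (prune X y lam t0)
    if gOf X y t' R < lam then .leaf R else t'

/-- `TREE^λ(y)`: the CART tree, grown by Algorithm 1 and pruned by Algorithm 2. -/
def cart (X : Fin n → Fin p → ℝ) (lam : ℝ) (y : Fin n → ℝ) : RTree p :=
  prune X y lam (tree0 X y)

/-- The set of regions of `TREE^λ(y)`. -/
def treeSet (X : Fin n → Fin p → ℝ) (lam : ℝ) (y : Fin n → ℝ) : Set (Region p) :=
  (cart X lam y).regions

/-- `A` and `B` are sibling regions in the collection of regions `T` (Definition 2). -/
def SiblingsIn (X : Fin n → Fin p → ℝ) (T : Set (Region p)) (A B : Region p) : Prop :=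
  ∃ R ∈ T, ∃ j : Fin p, ∃ s ∈ Finset.Icc 1 (n - 1),
    A ∈ T ∧ B ∈ T ∧
      ((A = R ∩ hsp X j s true ∧ B = R ∩ hsp X j s false) ∨
        (A = R ∩ hsp X j s false ∧ B = R ∩ hsp X j s true))

/-- The contrast vector `ν_sib` (equation (5)). -/
def nuSib (X : Fin n → Fin p → ℝ) (A B : Region p) : Fin n → ℝ := fun i =>
  (if X i ∈ A then (1 : ℝ) else 0) / (obs X A).card
    - (if X i ∈ B then (1 : ℝ) else 0) / (obs X B).card

/-- The contrast vector `ν_reg` (equation (12)). -/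
def nuReg (X : Fin n → Fin p → ℝ) (A : Region p) : Fin n → ℝ := fun i =>
  (if X i ∈ A then (1 : ℝ) else 0) / (obs X A).card

/-- Euclidean inner product on `ℝ^n`. -/
def dot (v w : Fin n → ℝ) : ℝ := ∑ i, v i * w i

/-- `P_ν^⊥ y = y - (ν^T y / ‖ν‖²) ν`, the projection orthogonal to `ν`. -/
def pperp (ν y : Fin n → ℝ) : Fin n → ℝ := fun i => y i - dot ν y / dot ν ν * ν i

/-- `y'(φ, ν) = P_ν^⊥ y + φ ν / ‖ν‖²`. -/
def yprime (y ν : Fin n → ℝ) (φ : ℝ) : Fin n → ℝ := fun i =>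
  pperp ν y i + φ * ν i / dot ν ν

/-- The conditioning set `S_sib^λ(ν_sib)` (equation (8)). -/
def Ssib (X : Fin n → Fin p → ℝ) (lam : ℝ) (A B : Region p) (y : Fin n → ℝ) : Set ℝ :=
  {φ | SiblingsIn X (treeSet X lam (yprime y (nuSib X A B) φ)) A B}

/-- The conditioning set `S_reg^λ(ν_reg)` (equation (14)). -/
def Sreg (X : Fin n → Fin p → ℝ) (lam : ℝ) (A : Region p) (y : Fin n → ℝ) : Set ℝ :=
  {φ | A ∈ treeSet X lam (yprime y (nuReg X A) φ)}

/-- The law of `Y ~ N_n(μ, σ² I_n)`. -/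
def gaussianVec (μ : Fin n → ℝ) (σ2 : ℝ≥0) : Measure (Fin n → ℝ) :=
  Measure.pi fun i => gaussianReal (μ i) σ2

/-- `σ² ‖ν‖²`, the variance of `ν^T Y`. -/
def nuVar (σ2 : ℝ≥0) (ν : Fin n → ℝ) : ℝ≥0 := σ2 * (dot ν ν).toNNReal

/-- The conditional distribution of `Y` given `P_ν^⊥ Y = P_ν^⊥ y`, when `ν^T μ = m`
and `Var(ν^T Y) = v`: the law of `y'(φ, ν)` with `φ ~ N(m, v)`. -/
def condLaw (y ν : Fin n → ℝ) (m : ℝ) (v : ℝ≥0) : Measure (Fin n → ℝ) :=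
  Measure.map (yprime y ν) (gaussianReal m v)

/-- The `N(m, v)` distribution truncated to the set `S`. -/
def truncGaussian (m : ℝ) (v : ℝ≥0) (S : Set ℝ) : Measure ℝ :=
  (gaussianReal m v)[|S]

/-- `F(t; m, v, S)`: the cumulative distribution function of the `N(m, v)`
distribution truncated to `S`. -/
def tnCDF (t m : ℝ) (v : ℝ≥0) (S : Set ℝ) : ℝ :=
  (truncGaussian m v S (Set.Iic t)).toReal

/-- The p-value `p_sib(w)` of equation (7): the probability, under `H_0 : ν_sib^T μ = 0`
and under the conditional distribution of `Y` given `P_{ν_sib}^⊥ Y = P_{ν_sib}^⊥ w`,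
that `|ν_sib^T Y| ≥ |ν_sib^T w|` given that `R_A, R_B` are siblings in `TREE^λ(Y)`. -/
def psib (X : Fin n → Fin p → ℝ) (lam : ℝ) (A B : Region p) (σ2 : ℝ≥0)
    (w : Fin n → ℝ) : ℝ :=
  ((condLaw w (nuSib X A B) 0 (nuVar σ2 (nuSib X A B)))[|{u | SiblingsIn X (treeSet X lam u) A B}]
      {u | |dot (nuSib X A B) w| ≤ |dot (nuSib X A B) u|}).toReal

/-- The p-value `p_reg(w)` of equation (13), for `H_0 : ν_reg^T μ = c`. -/
def preg (X : Fin n → Fin p → ℝ) (lam : ℝ) (A : Region p) (c : ℝ) (σ2 : ℝ≥0)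
    (w : Fin n → ℝ) : ℝ :=
  ((condLaw w (nuReg X A) c (nuVar σ2 (nuReg X A)))[|{u | A ∈ treeSet X lam u}]
      {u | |dot (nuReg X A) w - c| ≤ |dot (nuReg X A) u - c|}).toReal

/-- A branch (Definition 7): an ordered sequence of triples `(j, s, e)`. -/
abbrev Branch (p : ℕ) := List (Fin p × ℕ × Bool)

/-- The region `R^(l)` induced by the first `l` triples of the branch. -/
def branchRegion (X : Fin n → Fin p → ℝ) (Bq : Branch p) (l : ℕ) : Region p :=
  (Bq.take l).foldl (fun R q => R ∩ hsp X q.1 q.2.1 q.2.2) Set.univ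

/-- `R(B) = {R^(0), …, R^(L)}`, the nested regions induced by the branch `B`. -/
def branchRegions (X : Fin n → Fin p → ℝ) (Bq : Branch p) : Set (Region p) :=
  {R | ∃ l ≤ Bq.length, R = branchRegion X Bq l}

/-- `S_grow(B, ν) = {φ : R(B) ⊆ TREE^0(y'(φ, ν))}` (equation (19)). -/
def Sgrow (X : Fin n → Fin p → ℝ) (Bq : Branch p) (ν y : Fin n → ℝ) : Set ℝ :=
  {φ | branchRegions X Bq ⊆ (tree0 X (yprime y ν φ)).regions}

/-- `S^λ(B, ν) = {φ : R(B) ⊆ TREE^λ(y'(φ, ν))}` (equation (15)). -/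
def Slam (X : Fin n → Fin p → ℝ) (lam : ℝ) (Bq : Branch p) (ν y : Fin n → ℝ) : Set ℝ :=
  {φ | branchRegions X Bq ⊆ treeSet X lam (yprime y ν φ)}

/-- `branch(R, TREE)`: the branch leading from the root of the tree to the region `R`. -/
def RTree.branchTo : RTree p → Region p → Branch p
  | .leaf _, _ => []
  | .node R' q t1 t0, R =>
    if R = R' then []
    else if R ∈ t1.regions then (q.1, q.2, true) :: t1.branchTo R
    else if R ∈ t0.regions then (q.1, q.2, false) :: t0.branchTo R
    else []

/-- The permuted branch `π(B)` (Definition 8). -/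
def permBranch (Bq : Branch p) (π : Equiv.Perm (Fin Bq.length)) : Branch p :=
  List.ofFn fun k => Bq.get (π k)

/-- The region `R^(L-1) ∩ χ_{j_L, s_L, 1 - e_L}` appearing in Condition 1. -/
def lastSibRegion (X : Fin n → Fin p → ℝ) (Bq : Branch p) : Region p :=
  match Bq.getLast? with
  | none => ∅
  | some q => branchRegion X Bq (Bq.length - 1) ∩ hsp X q.1 q.2.1 (!q.2.2)

/-- Condition 1: for every `φ` there are constants `c₁, c₂` with
`y'(φ, ν)_i = y_i + c₁ 1(x_i ∈ R^(L)) + c₂ 1(x_i ∈ R^(L-1) ∩ χ_{j_L, s_L, 1-e_L})`. -/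
def Condition1 (X : Fin n → Fin p → ℝ) (y ν : Fin n → ℝ) (Bq : Branch p) : Prop :=
  ∀ φ : ℝ, ∃ c1 c2 : ℝ, ∀ i,
    yprime y ν φ i =
      y i + c1 * (if X i ∈ branchRegion X Bq Bq.length then 1 else 0)
        + c2 * (if X i ∈ lastSibRegion X Bq then 1 else 0)

/-- The indicator vector `1(R) ∈ ℝ^n` of a region. -/
def indVec (X : Fin n → Fin p → ℝ) (R : Region p) : Fin n → ℝ := fun i =>
  if X i ∈ R then 1 else 0

/-- The orthogonal projection matrix `P_v = v (v^T v)⁻¹ v^T` onto the vector `v`. -/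
def projMat (v : Fin n → ℝ) : Matrix (Fin n) (Fin n) ℝ :=
  (dot v v)⁻¹ • Matrix.of fun i k => v i * v k

/-- The matrix `M_{R,j,s}` of equation (C.1). -/
def Mmat (X : Fin n → Fin p → ℝ) (R : Region p) (j : Fin p) (s : ℕ) :
    Matrix (Fin n) (Fin n) ℝ :=
  projMat (indVec X (R ∩ hsp X j s true)) + projMat (indVec X (R ∩ hsp X j s false))
    - projMat (indVec X R)

/-- The quadratic coefficient `a(R, j, s) = ν^T M_{R,j,s} ν / ‖ν‖⁴`. -/
def qa (X : Fin n → Fin p → ℝ) (ν : Fin n → ℝ) (R : Region p) (j : Fin p) (s : ℕ) : ℝ :=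
  dot ν ((Mmat X R j s).mulVec ν) / (dot ν ν) ^ 2

/-- The linear coefficient `b(R, j, s) = 2 ν^T M_{R,j,s} P_ν^⊥ y / ‖ν‖²`. -/
def qb (X : Fin n → Fin p → ℝ) (ν y : Fin n → ℝ) (R : Region p) (j : Fin p) (s : ℕ) : ℝ :=
  2 * dot ν ((Mmat X R j s).mulVec (pperp ν y)) / dot ν ν

/-- The constant coefficient `c(R, j, s) = y^T P_ν^⊥ M_{R,j,s} P_ν^⊥ y`. -/
def qc (X : Fin n → Fin p → ℝ) (ν y : Fin n → ℝ) (R : Region p) (j : Fin p) (s : ℕ) : ℝ :=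
  dot (pperp ν y) ((Mmat X R j s).mulVec (pperp ν y))

/-- The identity of Proposition 5 (equation (20)), for a candidate tree `T = TREE(B, ν, λ)`. -/
def Prop5Identity (X : Fin n → Fin p → ℝ) (lam : ℝ) (Bq : Branch p) (ν y : Fin n → ℝ)
    (T : RTree p) : Prop :=
  Slam X lam Bq ν y =
    Sgrow X Bq ν y ∩
      ⋂ l : Fin Bq.length, {φ | lam ≤ gOf X (yprime y ν φ) T (branchRegion X Bq l)}

/-- One step of Algorithm 2: remove the descendants of `R` if `g(R, TREE, y) < λ`. -/
def pruneAt (X : Fin n → Fin p → ℝ) (y : Fin n → ℝ) (lam : ℝ) : RTree p → Region p → RTree p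
  | .leaf R', _ => .leaf R'
  | .node R' q t1 t0, R =>
    if R = R' then
      if gOf X y (RTree.node R' q t1 t0) R < lam then .leaf R' else .node R' q t1 t0
    else .node R' q (pruneAt X y lam t1 R) (pruneAt X y lam t0 R)

/-- The intermediate trees of Algorithm 2: `pruneSteps X y λ TREE O` is
`TREE_k(TREE, y, λ, O)` when `O` is the list of the first `k` regions of the ordering. -/
def pruneSteps (X : Fin n → Fin p → ℝ) (y : Fin n → ℝ) (lam : ℝ) (t : RTree p) :
    List (Region p) → RTree p
  | [] => t
  | R :: rest => pruneSteps X y lam (pruneAt X y lam t R) rest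

/-- `desc(R, T)`: the (proper) descendants of `R` among the regions `T` (Definition 3). -/
def descIn (T : Set (Region p)) (R : Region p) : Set (Region p) :=
  {R' ∈ T | R' ⊆ R ∧ R' ≠ R}

/-- `O` is a bottom-up ordering of the regions of the tree `t` (Definition 6):
it enumerates all regions, and every region precedes all of its ancestors. -/
def BottomUp (t : RTree p) (O : List (Region p)) : Prop :=
  O.Perm t.regionList ∧
    ∀ k j : Fin O.length, O.get k ∈ descIn t.regions (O.get j) → (k : ℕ) ≤ (j : ℕ)

/-- A set-based tree (Definition 1). -/
def IsTreeSet (X : Fin n → Fin p → ℝ) (T : Finset (Region p)) : Prop :=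
  (Set.univ : Region p) ∈ T ∧
    (∀ R ∈ T, R ≠ Set.univ → ∃ R' ∈ T, ∃ j : Fin p, ∃ s ∈ Finset.Icc 1 (n - 1), ∃ e : Bool,
      R = R' ∩ hsp X j s e) ∧
    (∀ R' ∈ T, ∀ j : Fin p, ∀ s ∈ Finset.Icc 1 (n - 1), ∀ e : Bool,
      R' ∩ hsp X j s e ∈ T → R' ∩ hsp X j s (!e) ∈ T)

/-- `term(R, T)` for a set-based tree: the regions of `T` contained in `R`
having no proper descendants in `T`. -/
def termOf (T : Finset (Region p)) (R : Region p) : Finset (Region p) :=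
  T.filter fun r => r ⊆ R ∧ ∀ r' ∈ T, r' ⊆ r → r' = r

/-- `h(R, TREE, y)` (equation (D.1)): the decrease in the sum of squared errors
provided by the terminal descendants of `R`. -/
def hset (X : Fin n → Fin p → ℝ) (y : Fin n → ℝ) (T : Finset (Region p)) (R : Region p) : ℝ :=
  sse X y R - ∑ r ∈ termOf T R, sse X y r

/-- The p-value `p_reg^Q(w)` of Proposition 8, for `H_0 : ν_reg^T μ = c`. -/
def pregQ (X : Fin n → Fin p → ℝ) (lam : ℝ) (A : Region p) (Bq : Branch p)
    (Q : Set (Equiv.Perm (Fin Bq.length))) (c : ℝ) (σ2 : ℝ≥0) (w : Fin n → ℝ) : ℝ :=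
  ((condLaw w (nuReg X A) c (nuVar σ2 (nuReg X A)))[|{u | ∃ π ∈ Q,
        branchRegions X (permBranch Bq π) ⊆ treeSet X lam u}]
      {u | |dot (nuReg X A) w - c| ≤ |dot (nuReg X A) u - c|}).toReal

end TreeValues
namespace TreeValues

theorem dot_eq_dotProduct {n : ℕ} (v w : Fin n → ℝ) : dot v w = v ⬝ᵥ w := rfl

theorem dot_comm {n : ℕ} (v w : Fin n → ℝ) : dot v w = dot w v := dotProduct_comm v w

theorem dot_projMat_mulVec {n : ℕ} (u w v : Fin n → ℝ) :
    dot u ((projMat w).mulVec v) = (dot w w)⁻¹ * (dot u w * dot w v) := by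
  have h : (Matrix.of fun i k => w i * w k) = Matrix.vecMulVec w w := rfl
  rw [projMat, h, Matrix.smul_mulVec, Matrix.vecMulVec_mulVec]
  simp only [dot_eq_dotProduct, dotProduct_smul, smul_eq_mul, op_smul_eq_smul]
  ring

theorem dot_indVec {n p : ℕ} (X : Fin n → Fin p → ℝ) (R : Region p) (v : Fin n → ℝ) :
    dot (indVec X R) v = ∑ i ∈ obs X R, v i := by
  simp [dot, indVec, obs, Finset.sum_filter]

theorem dot_indVec_self {n p : ℕ} (X : Fin n → Fin p → ℝ) (R : Region p) :
    dot (indVec X R) (indVec X R) = (obs X R).card := by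
  rw [dot_indVec, Finset.cast_card]
  refine Finset.sum_congr rfl fun i hi => ?_
  exact if_pos (Finset.mem_filter.1 hi).2

theorem sse_eq_sum_sq_sub {n p : ℕ} (X : Fin n → Fin p → ℝ) (y : Fin n → ℝ) (R : Region p) :
    sse X y R =
      ∑ i ∈ obs X R, y i ^ 2 - dot y ((projMat (indVec X R)).mulVec y) := by
  rw [dot_projMat_mulVec, dot_indVec_self, dot_comm y, dot_indVec, sse, regMean]
  simp only [sub_sq, Finset.sum_add_distrib, Finset.sum_sub_distrib, ← Finset.sum_mul,
    ← Finset.mul_sum, Finset.sum_const, nsmul_eq_mul]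
  rcases eq_or_ne ((obs X R).card : ℝ) 0 with h | h
  · simp [h]
  · field_simp
    ring

theorem sum_obs_inter_hsp {n p : ℕ} (X : Fin n → Fin p → ℝ) (R : Region p) (j : Fin p) (s : ℕ)
    (f : Fin n → ℝ) :
    ∑ i ∈ obs X (R ∩ hsp X j s true), f i + ∑ i ∈ obs X (R ∩ hsp X j s false), f i =
      ∑ i ∈ obs X R, f i := by
  rw [← Finset.sum_filter_add_sum_filter_not (obs X R) (fun i => X i j ≤ orderStat X j s)]
  congr 2 <;> ext i <;> simp [obs, hsp]

theorem gain_eq_dot_Mmat_mulVec {n p : ℕ} (X : Fin n → Fin p → ℝ) (y : Fin n → ℝ) (R : Region p)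
    (j : Fin p) (s : ℕ) :
    gain X y R j s = dot y ((Mmat X R j s).mulVec y) := by
  rw [gain, Mmat]
  simp only [sse_eq_sum_sq_sub, ← sum_obs_inter_hsp X R j s, dot_eq_dotProduct,
    Matrix.sub_mulVec, Matrix.add_mulVec, dotProduct_add, dotProduct_sub]
  ring

theorem dot_Mmat_mulVec_comm {n p : ℕ} (X : Fin n → Fin p → ℝ) (R : Region p) (j : Fin p) (s : ℕ)
    (u v : Fin n → ℝ) :
    dot u ((Mmat X R j s).mulVec v) = dot v ((Mmat X R j s).mulVec u) := by
  have h (w : Fin n → ℝ) :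
      dot u ((projMat w).mulVec v) = dot v ((projMat w).mulVec u) := by
    rw [dot_projMat_mulVec, dot_projMat_mulVec, dot_comm u, dot_comm v]
    ring
  simp only [dot_eq_dotProduct] at h
  simp only [Mmat, dot_eq_dotProduct, Matrix.sub_mulVec, Matrix.add_mulVec, dotProduct_add,
    dotProduct_sub, h]

theorem yprime_eq_add_smul {n : ℕ} (y ν : Fin n → ℝ) (φ : ℝ) :
    yprime y ν φ = pperp ν y + (φ / dot ν ν) • ν := by
  ext i
  simp [yprime, div_mul_eq_mul_div]

theorem gain_yprime {n p : ℕ} (X : Fin n → Fin p → ℝ) (y ν : Fin n → ℝ) (R : Region p)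
    (j : Fin p) (s : ℕ) (φ : ℝ) :
    gain X (yprime y ν φ) R j s =
      qa X ν R j s * φ ^ 2 + qb X ν y R j s * φ + qc X ν y R j s := by
  have h := dot_Mmat_mulVec_comm X R j s (pperp ν y) ν
  rw [gain_eq_dot_Mmat_mulVec, yprime_eq_add_smul, qa, qb, qc]
  generalize dot ν ν = d
  simp only [dot_eq_dotProduct, Matrix.mulVec_add, Matrix.mulVec_smul, dotProduct_add,
    add_dotProduct, dotProduct_smul, smul_dotProduct, smul_eq_mul] at h ⊢
  rw [h]
  ring

/-- **Proposition 4 / Lemma C.2.** The gain is a quadratic in `φ`: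
`Gain_R(y'(φ,ν), j, s) = a(R,j,s) φ² + b(R,j,s) φ + c(R,j,s)` with
`a = ν^T M ν / ‖ν‖⁴`, `b = 2 ν^T M P_ν^⊥ y / ‖ν‖²`, `c = y^T P_ν^⊥ M P_ν^⊥ y`;
consequently each set `S_{l,j,s}` is the solution set of a quadratic inequality in `φ`
whose coefficients are the corresponding coefficient differences. -/
theorem gain_is_quadratic {n p : ℕ} (X : Fin n → Fin p → ℝ) (y ν : Fin n → ℝ) :
    (∀ (R : Region p) (j : Fin p) (s : ℕ) (φ : ℝ),
        gain X (yprime y ν φ) R j s =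
          qa X ν R j s * φ ^ 2 + qb X ν y R j s * φ + qc X ν y R j s) ∧
    ∀ (Bq : Branch p) (l : Fin Bq.length) (j : Fin p) (s : ℕ),
      {φ : ℝ |
          gain X (yprime y ν φ) (branchRegion X Bq l) j s ≤
            gain X (yprime y ν φ) (branchRegion X Bq l) (Bq.get l).1 (Bq.get l).2.1} =
        {φ : ℝ |
          (qa X ν (branchRegion X Bq l) j s
              - qa X ν (branchRegion X Bq l) (Bq.get l).1 (Bq.get l).2.1) * φ ^ 2 +
            (qb X ν y (branchRegion X Bq l) j s
              - qb X ν y (branchRegion X Bq l) (Bq.get l).1 (Bq.get l).2.1) * φ +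
            (qc X ν y (branchRegion X Bq l) j s
              - qc X ν y (branchRegion X Bq l) (Bq.get l).1 (Bq.get l).2.1) ≤ 0} := by
  refine ⟨gain_yprime X y ν, fun Bq l j s => ?_⟩
  ext φ
  rw [Set.mem_ofPred_eq, Set.mem_ofPred_eq, gain_yprime, gain_yprime, ← sub_nonpos]
  ring_nf

end TreeValues
end
end

section
/- Let B be a branch with induced regions R^(0),…,R^(L), let ν ∈ R^n satisfy Condition 1 with respect to B, and let TREE(B,ν,λ) be a tree satisfying the identity of Proposition 5. Then the set ∩_{l=0}^{L−1} { φ : g(R^(l), TREE(B,ν,λ), y'(φ,ν)) ≥ λ } is the intersection of L sets, each of which is the solution set of a quadratic inequality in φ. (Proposition 6, first statement.) -/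
/-
Formalization of the selective inference framework for CART
("Tree-Values: selective inference for regression trees").

We set up the CART algorithm (growing via greedy gain maximization,
Algorithm 1, and cost-complexity pruning, Algorithm 2), contrast vectors,
conditioning sets, and the relevant conditional probabilities.

Conditioning on the measure-zero event `P_ν^⊥ Y = P_ν^⊥ y` is formalized
via the regular conditional distribution of `Y` given `P_ν^⊥ Y = P_ν^⊥ y`:
since `Y = P_ν^⊥ Y + (ν^T Y) ν / ‖ν‖²` with `ν^T Y ~ N(ν^T μ, σ²‖ν‖²)`
independent of `P_ν^⊥ Y`, this conditional distribution is the law of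
`φ ↦ y'(φ, ν)` where `φ ~ N(ν^T μ, σ²‖ν‖²)`.
-/

open MeasureTheory ProbabilityTheory
open scoped ENNReal NNReal Classical

noncomputable section

namespace TreeValues

/-- `f` is a polynomial function of degree at most two. -/
def IsQuadratic (f : ℝ → ℝ) : Prop := ∃ a b c : ℝ, ∀ φ, f φ = a * φ ^ 2 + b * φ + c

namespace IsQuadratic

variable {f g : ℝ → ℝ}

lemma const (c : ℝ) : IsQuadratic fun _ => c := ⟨0, 0, c, fun _ => by ring⟩

lemma add (hf : IsQuadratic f) (hg : IsQuadratic g) : IsQuadratic fun φ => f φ + g φ := by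
  obtain ⟨a, b, c, hf⟩ := hf
  obtain ⟨a', b', c', hg⟩ := hg
  exact ⟨a + a', b + b', c + c', fun φ => by simp only [hf, hg]; ring⟩

lemma sub (hf : IsQuadratic f) (hg : IsQuadratic g) : IsQuadratic fun φ => f φ - g φ := by
  obtain ⟨a, b, c, hf⟩ := hf
  obtain ⟨a', b', c', hg⟩ := hg
  exact ⟨a - a', b - b', c - c', fun φ => by simp only [hf, hg]; ring⟩

lemma div_const (hf : IsQuadratic f) (d : ℝ) : IsQuadratic fun φ => f φ / d := by
  obtain ⟨a, b, c, hf⟩ := hf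
  exact ⟨a / d, b / d, c / d, fun φ => by simp only [hf]; ring⟩

lemma finset_sum {ι : Type*} {F : ι → ℝ → ℝ} (s : Finset ι) (hF : ∀ i, IsQuadratic (F i)) :
    IsQuadratic fun φ => ∑ i ∈ s, F i φ := by
  choose a b c h using hF
  refine ⟨∑ i ∈ s, a i, ∑ i ∈ s, b i, ∑ i ∈ s, c i, fun φ => ?_⟩
  simp only [h, Finset.sum_add_distrib, Finset.sum_mul]

lemma list_sum {ι : Type*} {F : ι → ℝ → ℝ} (l : List ι) (hF : ∀ i, IsQuadratic (F i)) :
    IsQuadratic fun φ => (l.map fun i => F i φ).sum := by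
  induction l with
  | nil => exact const 0
  | cons i l ih =>
    simp only [List.map_cons, List.sum_cons]
    exact (hF i).add ih

end IsQuadratic

variable {n p : ℕ}

lemma yprime_eq (y ν : Fin n → ℝ) (φ : ℝ) (i : Fin n) :
    yprime y ν φ i = ν i / dot ν ν * φ + pperp ν y i := by
  simp only [yprime]
  ring

lemma regMean_yprime (X : Fin n → Fin p → ℝ) (y ν : Fin n → ℝ) (R : Region p) (φ : ℝ) :
    regMean X (yprime y ν φ) R =
      regMean X (fun i => ν i / dot ν ν) R * φ + regMean X (pperp ν y) R := by
  simp only [regMean, yprime_eq, Finset.sum_add_distrib, ← Finset.sum_mul]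
  ring

lemma isQuadratic_sse_yprime (X : Fin n → Fin p → ℝ) (y ν : Fin n → ℝ) (R : Region p) :
    IsQuadratic fun φ => sse X (yprime y ν φ) R := by
  refine IsQuadratic.finset_sum _ fun i => ?_
  set u := ν i / dot ν ν - regMean X (fun k => ν k / dot ν ν) R with hu
  set v := pperp ν y i - regMean X (pperp ν y) R with hv
  refine ⟨u ^ 2, 2 * u * v, v ^ 2, fun φ => ?_⟩
  simp only [yprime_eq, regMean_yprime, hu, hv]
  ring

lemma isQuadratic_gOf_yprime (X : Fin n → Fin p → ℝ) (y ν : Fin n → ℝ) (T : RTree p)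
    (R : Region p) : IsQuadratic fun φ => gOf X (yprime y ν φ) T R :=
  ((isQuadratic_sse_yprime X y ν R).sub
    (IsQuadratic.list_sum (T.leavesBelow R) fun r => isQuadratic_sse_yprime X y ν r)).div_const _

/-- **Proposition 6, first statement.** For a tree `TREE(B,ν,λ)` satisfying the
identity of Proposition 5, the set
`∩_{l=0}^{L-1} {φ : g(R^(l), TREE(B,ν,λ), y'(φ,ν)) ≥ λ}` is the intersection of `L`
sets, each the solution set of a quadratic inequality in `φ`. -/
theorem prop_pruning_quadratic {n p : ℕ} (X : Fin n → Fin p → ℝ) (lam : ℝ)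
    (hlam : 0 ≤ lam) (y ν : Fin n → ℝ) (Bq : Branch p)
    (hcond : Condition1 X y ν Bq) (T : RTree p)
    (hT : Prop5Identity X lam Bq ν y T) :
    ∀ l : Fin Bq.length, ∃ a b c : ℝ,
      {φ : ℝ | lam ≤ gOf X (yprime y ν φ) T (branchRegion X Bq l)} =
        {φ : ℝ | 0 ≤ a * φ ^ 2 + b * φ + c} := by
  intro l
  obtain ⟨a, b, c, h⟩ :=
    (isQuadratic_gOf_yprime X y ν T (branchRegion X Bq l)).sub (IsQuadratic.const lam)
  refine ⟨a, b, c, Set.ext fun φ => ?_⟩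
  rw [Set.mem_ofPred_eq, Set.mem_ofPred_eq, ← h, sub_nonneg]

end TreeValues
end
end

section
/- Condition 1 holds in each of the following two cases: (i) B = branch(R_A, TREE^λ(y)) and ν = ν_sib, where R_A and R_B are siblings in TREE^λ(y); (ii) B is any permutation of branch(R_A, TREE^λ(y)) and ν = ν_reg, where R_A ∈ TREE^λ(y). (Proposition 7.) -/
/-
Formalization of the selective inference framework for CART
("Tree-Values: selective inference for regression trees").

We set up the CART algorithm (growing via greedy gain maximization,
Algorithm 1, and cost-complexity pruning, Algorithm 2), contrast vectors,
conditioning sets, and the relevant conditional probabilities.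

Conditioning on the measure-zero event `P_ν^⊥ Y = P_ν^⊥ y` is formalized
via the regular conditional distribution of `Y` given `P_ν^⊥ Y = P_ν^⊥ y`:
since `Y = P_ν^⊥ Y + (ν^T Y) ν / ‖ν‖²` with `ν^T Y ~ N(ν^T μ, σ²‖ν‖²)`
independent of `P_ν^⊥ Y`, this conditional distribution is the law of
`φ ↦ y'(φ, ν)` where `φ ~ N(ν^T μ, σ²‖ν‖²)`.
-/

open MeasureTheory ProbabilityTheory
open scoped ENNReal NNReal Classical

noncomputable section

namespace TreeValues

lemma hsp_not {n p : ℕ} (X : Fin n → Fin p → ℝ) (j : Fin p) (s : ℕ) (e : Bool) :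
    hsp X j s (!e) = (hsp X j s e)ᶜ := by
  cases e <;> ext z <;> simp [hsp]

/-- Every region is nonempty, and the two subtrees of an internal node are rooted at the two
halves of its region. -/
def RTree.WellFormed {n p : ℕ} (X : Fin n → Fin p → ℝ) : RTree p → Prop
  | .leaf R => R.Nonempty
  | .node R q t1 t0 =>
    R.Nonempty ∧ t1.root = R ∩ hsp X q.1 q.2 true ∧ t0.root = R ∩ hsp X q.1 q.2 false ∧
      t1.WellFormed X ∧ t0.WellFormed X

namespace RTree

variable {n p : ℕ} {X : Fin n → Fin p → ℝ}

lemma root_mem_regions (t : RTree p) : t.root ∈ t.regions := by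
  cases t <;> simp [root, regions]

lemma WellFormed.nonempty {t : RTree p} (ht : t.WellFormed X) {C : Region p}
    (hC : C ∈ t.regions) : C.Nonempty := by
  induction t with
  | leaf R =>
    obtain rfl : C = R := hC
    exact ht
  | node R q t1 t0 ih1 ih0 =>
    obtain ⟨hR, -, -, h1, h0⟩ := ht
    rcases hC with rfl | hC | hC
    exacts [hR, ih1 h1 hC, ih0 h0 hC]

lemma WellFormed.subset_root {t : RTree p} (ht : t.WellFormed X) {C : Region p}
    (hC : C ∈ t.regions) : C ⊆ t.root := by
  induction t with
  | leaf R => exact (show C = R from hC).subset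
  | node R q t1 t0 ih1 ih0 =>
    obtain ⟨-, r1, r0, h1, h0⟩ := ht
    rcases hC with rfl | hC | hC
    · exact subset_rfl
    · exact (ih1 h1 hC).trans (r1 ▸ Set.inter_subset_left)
    · exact (ih0 h0 hC).trans (r0 ▸ Set.inter_subset_left)

/-- The regions of a well-formed tree form a laminar family. -/
lemma WellFormed.laminar {t : RTree p} (ht : t.WellFormed X) {C D : Region p}
    (hC : C ∈ t.regions) (hD : D ∈ t.regions) : C ⊆ D ∨ D ⊆ C ∨ Disjoint C D := by
  induction t with
  | leaf R =>
    obtain rfl : C = R := hC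
    obtain rfl : D = C := hD
    exact .inl subset_rfl
  | node R q t1 t0 ih1 ih0 =>
    have hCR := ht.subset_root hC
    have hDR := ht.subset_root hD
    obtain ⟨-, r1, r0, h1, h0⟩ := ht
    have hdisj : Disjoint t1.root t0.root := by
      rw [r1, r0, show false = !true from rfl, hsp_not]
      exact disjoint_compl_right.mono Set.inter_subset_right Set.inter_subset_right
    rcases hC with rfl | hC | hC
    · exact .inr (.inl hDR)
    · rcases hD with rfl | hD | hD
      · exact .inl hCR
      · exact ih1 h1 hC hD
      · exact .inr (.inr (hdisj.mono (h1.subset_root hC) (h0.subset_root hD)))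
    · rcases hD with rfl | hD | hD
      · exact .inl hCR
      · exact .inr (.inr (hdisj.symm.mono (h0.subset_root hC) (h1.subset_root hD)))
      · exact ih0 h0 hC hD

lemma WellFormed.foldl_branchTo {t : RTree p} (ht : t.WellFormed X) {A : Region p}
    (hA : A ∈ t.regions) :
    (t.branchTo A).foldl (fun R q => R ∩ hsp X q.1 q.2.1 q.2.2) t.root = A := by
  induction t with
  | leaf R => exact (show A = R from hA).symm
  | node R q t1 t0 ih1 ih0 =>
    obtain ⟨-, r1, r0, h1, h0⟩ := ht
    unfold branchTo
    split_ifs with hR hA1 hA0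
    · exact hR.symm
    · have h := ih1 h1 hA1
      rw [r1] at h
      exact h
    · have h := ih0 h0 hA0
      rw [r0] at h
      exact h
    · rcases hA with h | h | h
      exacts [(hR h).elim, (hA1 h).elim, (hA0 h).elim]

/-- The branch to a region other than the root ends with the split of its parent, and the
other half of the parent is also a region of the tree. -/
lemma WellFormed.branchTo_eq_append {t : RTree p} (ht : t.WellFormed X) {A : Region p}
    (hA : A ∈ t.regions) (hne : A ≠ t.root) :
    ∃ b q, t.branchTo A = b ++ [q] ∧
      b.foldl (fun R q => R ∩ hsp X q.1 q.2.1 q.2.2) t.root ∈ t.regions ∧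
      b.foldl (fun R q => R ∩ hsp X q.1 q.2.1 q.2.2) t.root ∩ hsp X q.1 q.2.1 (!q.2.2)
        ∈ t.regions := by
  induction t with
  | leaf R => exact (hne hA).elim
  | node R q t1 t0 ih1 ih0 =>
    obtain ⟨-, r1, r0, h1, h0⟩ := ht
    have nil_of_root (t : RTree p) : t.branchTo t.root = [] := by
      cases t <;> simp [branchTo, root]
    unfold branchTo
    split_ifs with hR hA1 hA0
    · exact (hne hR).elim
    · by_cases hr : A = t1.root
      · refine ⟨[], (q.1, q.2, true), by rw [hr, nil_of_root]; rfl, .inl rfl, ?_⟩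
        refine .inr (.inr ?_)
        exact r0 ▸ t0.root_mem_regions
      · obtain ⟨b, q', hb, hP, hS⟩ := ih1 h1 hA1 hr
        refine ⟨(q.1, q.2, true) :: b, q', by rw [hb]; rfl, .inr (.inl ?_), .inr (.inl ?_)⟩
        · rw [r1] at hP
          exact hP
        · rw [r1] at hS
          exact hS
    · by_cases hr : A = t0.root
      · refine ⟨[], (q.1, q.2, false), by rw [hr, nil_of_root]; rfl, .inl rfl, ?_⟩
        refine .inr (.inl ?_)
        exact r1 ▸ t1.root_mem_regions
      · obtain ⟨b, q', hb, hP, hS⟩ := ih0 h0 hA0 hr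
        refine ⟨(q.1, q.2, false) :: b, q', by rw [hb]; rfl, .inr (.inr ?_), .inr (.inr ?_)⟩
        · rw [r0] at hP
          exact hP
        · rw [r0] at hS
          exact hS
    · rcases hA with h | h | h
      exacts [(hR h).elim, (hA1 h).elim, (hA0 h).elim]

/-- In a well-formed tree, the sibling of a region is determined by the region. -/
lemma WellFormed.sibling_unique {t : RTree p} (ht : t.WellFormed X) {P R H K : Region p}
    (hP : P ∈ t.regions) (hR : R ∈ t.regions) (hPH : P ∩ H ∈ t.regions)
    (hPH' : P ∩ Hᶜ ∈ t.regions) (hRK' : R ∩ Kᶜ ∈ t.regions)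
    (heq : P ∩ H = R ∩ K) : R ∩ Kᶜ = P ∩ Hᶜ := by
  obtain ⟨a, haP, haH⟩ := ht.nonempty hPH
  obtain ⟨b, hbP, hbH⟩ := ht.nonempty hPH'
  obtain ⟨c, hcR, hcK⟩ := ht.nonempty hRK'
  have key (z : Fin p → ℝ) : z ∈ P ∧ z ∈ H ↔ z ∈ R ∧ z ∈ K := Set.ext_iff.mp heq z
  have haRK := (key a).1 ⟨haP, haH⟩
  have hPR : P = R := by
    rcases ht.laminar hP hR with h | h | h
    · refine h.antisymm fun z hz => ?_
      rcases ht.laminar hRK' hP with h' | h' | h'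
      · by_cases hzK : z ∈ K
        · exact ((key z).2 ⟨hz, hzK⟩).1
        · exact h' ⟨hz, hzK⟩
      · exact ((h' haP).2 haRK.2).elim
      · refine (hbH ((key b).2 ⟨h hbP, ?_⟩).2).elim
        by_contra hbK
        exact Set.disjoint_left.mp h' ⟨h hbP, hbK⟩ hbP
    · refine Set.Subset.antisymm (fun z hz => ?_) h
      rcases ht.laminar hPH' hR with h' | h' | h'
      · by_cases hzH : z ∈ H
        · exact ((key z).1 ⟨hz, hzH⟩).1
        · exact h' ⟨hz, hzH⟩
      · exact ((h' haRK.1).2 haH).elim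
      · refine (hcK ((key c).1 ⟨h hcR, ?_⟩).2).elim
        by_contra hcH
        exact Set.disjoint_left.mp h' ⟨h hcR, hcH⟩ hcR
    · exact (Set.disjoint_left.mp h haP haRK.1).elim
  subst hPR
  ext z
  have := key z
  simp only [Set.mem_inter_iff, Set.mem_compl_iff]
  tauto

end RTree

section Cart

variable {n p : ℕ} (X : Fin n → Fin p → ℝ) (y : Fin n → ℝ)

lemma sse_eq_zero_of_obs_eq_empty {R : Region p} (h : obs X R = ∅) : sse X y R = 0 := by
  simp [sse, h]

lemma sse_congr {R S : Region p} (h : obs X R = obs X S) : sse X y R = sse X y S := by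
  simp [sse, regMean, h]

/-- A split with positive gain leaves observations on both sides. -/
lemma inter_hsp_nonempty_of_gain_pos {R : Region p} {j : Fin p} {s : ℕ}
    (h : 0 < gain X y R j s) (e : Bool) : (R ∩ hsp X j s e).Nonempty := by
  by_contra hne
  rw [Set.not_nonempty_iff_eq_empty] at hne
  have hempty : obs X (R ∩ hsp X j s e) = ∅ := by simp [hne, obs]
  have hother : R ∩ hsp X j s (!e) = R := by
    rw [hsp_not, Set.inter_eq_left, Set.subset_compl_iff_disjoint_right]
    exact Set.disjoint_iff_inter_eq_empty.mpr hne
  have h0 := sse_eq_zero_of_obs_eq_empty X y hempty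
  have h1 := congrArg (sse X y) hother
  unfold gain at h
  cases e <;> simp only [Bool.not_true, Bool.not_false] at h1 <;> linarith

lemma root_grow (k : ℕ) (R : Region p) : (grow X y k R).root = R := by
  cases k with
  | zero => rfl
  | succ k =>
    unfold grow
    split
    · rfl
    · split_ifs <;> rfl

lemma wellFormed_grow (k : ℕ) {R : Region p} (hR : R.Nonempty) :
    (grow X y k R).WellFormed X := by
  induction k generalizing R with
  | zero => exact hR
  | succ k ih =>
    unfold grow
    split
    · exact hR
    · split_ifs with h
      · exact hR
      · have hg := lt_of_not_ge (not_or.mp h).1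
        exact ⟨hR, root_grow .., root_grow .., ih (inter_hsp_nonempty_of_gain_pos X y hg true),
          ih (inter_hsp_nonempty_of_gain_pos X y hg false)⟩

lemma root_prune (lam : ℝ) (t : RTree p) : (prune X y lam t).root = t.root := by
  cases t with
  | leaf R => rfl
  | node R q t1 t0 =>
    simp only [prune]
    split_ifs <;> rfl

lemma wellFormed_prune (lam : ℝ) {t : RTree p} (ht : t.WellFormed X) :
    (prune X y lam t).WellFormed X := by
  induction t with
  | leaf R => exact ht
  | node R q t1 t0 ih1 ih0 =>
    obtain ⟨hR, r1, r0, h1, h0⟩ := ht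
    simp only [prune]
    split_ifs
    · exact hR
    · exact ⟨hR, (root_prune ..).trans r1, (root_prune ..).trans r0, ih1 h1, ih0 h0⟩

lemma wellFormed_cart (lam : ℝ) : (cart X lam y).WellFormed X :=
  wellFormed_prune X y lam (wellFormed_grow X y n Set.univ_nonempty)

lemma root_cart (lam : ℝ) : (cart X lam y).root = Set.univ :=
  (root_prune ..).trans (root_grow ..)

end Cart

lemma permBranch_perm {p : ℕ} (b : Branch p) (π : Equiv.Perm (Fin b.length)) :
    (permBranch b π).Perm b := by
  have h := Equiv.Perm.ofFn_comp_perm π b.get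
  rwa [List.ofFn_get] at h

lemma branchRegion_length {n p : ℕ} (X : Fin n → Fin p → ℝ) (b : Branch p) :
    branchRegion X b b.length =
      b.foldl (fun R q => R ∩ hsp X q.1 q.2.1 q.2.2) Set.univ := by
  simp [branchRegion]

lemma branchRegion_length_congr {n p : ℕ} (X : Fin n → Fin p → ℝ) {b b' : Branch p}
    (h : b.Perm b') : branchRegion X b b.length = branchRegion X b' b'.length := by
  rw [branchRegion_length, branchRegion_length]
  exact h.foldl_eq' (fun q _ r _ R => Set.inter_right_comm ..) _

lemma branchRegion_branchTo {n p : ℕ} (X : Fin n → Fin p → ℝ) (lam : ℝ) (y : Fin n → ℝ)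
    {A : Region p} (hA : A ∈ treeSet X lam y) :
    branchRegion X ((cart X lam y).branchTo A) ((cart X lam y).branchTo A).length = A := by
  rw [branchRegion_length, ← root_cart X y lam]
  exact (wellFormed_cart X y lam).foldl_branchTo hA

lemma lastSibRegion_append {n p : ℕ} (X : Fin n → Fin p → ℝ) (b : Branch p)
    (q : Fin p × ℕ × Bool) :
    lastSibRegion X (b ++ [q]) =
      b.foldl (fun R q => R ∩ hsp X q.1 q.2.1 q.2.2) Set.univ ∩ hsp X q.1 q.2.1 (!q.2.2) := by
  simp [lastSibRegion, branchRegion]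

lemma SiblingsIn.exists_split {n p : ℕ} {X : Fin n → Fin p → ℝ} {T : Set (Region p)}
    {A B : Region p} (h : SiblingsIn X T A B) :
    ∃ R ∈ T, ∃ K : Region p, A = R ∩ K ∧ B = R ∩ Kᶜ := by
  obtain ⟨R, hR, j, s, -, -, -, ⟨hA, hB⟩ | ⟨hA, hB⟩⟩ := h
  · exact ⟨R, hR, _, hA, by rw [hB, ← hsp_not, Bool.not_true]⟩
  · exact ⟨R, hR, _, hA, by rw [hB, ← hsp_not, Bool.not_false]⟩

/-- The last sibling region of the branch to a region is the sibling of that region. -/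
lemma lastSibRegion_branchTo {n p : ℕ} (X : Fin n → Fin p → ℝ) (lam : ℝ) (y : Fin n → ℝ)
    {A B : Region p} (h : SiblingsIn X (treeSet X lam y) A B) :
    lastSibRegion X ((cart X lam y).branchTo A) = B := by
  have ht := wellFormed_cart X y lam
  have hroot := root_cart X y lam
  have hA : A ∈ treeSet X lam y := by
    obtain ⟨-, -, -, -, -, hA, -⟩ := h
    exact hA
  have hB : B ∈ treeSet X lam y := by
    obtain ⟨-, -, -, -, -, -, hB, -⟩ := h
    exact hB
  obtain ⟨R, hR, K, hAK, hBK⟩ := h.exists_split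
  have hne : A ≠ (cart X lam y).root := by
    rw [hroot]
    rintro rfl
    obtain ⟨b, hb⟩ := ht.nonempty hB
    rw [hBK] at hb
    exact hb.2 (hAK.subset (Set.mem_univ b)).2
  obtain ⟨b, q, hb, hP, hS⟩ := ht.branchTo_eq_append hA hne
  have hbr := ht.foldl_branchTo hA
  rw [hb, List.foldl_append, List.foldl_cons, List.foldl_nil] at hbr
  rw [hb, lastSibRegion_append, ← hroot, hBK, hsp_not]
  rw [hsp_not] at hS
  exact (ht.sibling_unique hP hR (hbr.symm ▸ hA) hS (hBK ▸ hB) (hbr.trans hAK)).symm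

lemma yprime_apply {n : ℕ} (y ν : Fin n → ℝ) (φ : ℝ) (i : Fin n) :
    yprime y ν φ i = y i + (φ / dot ν ν - dot ν y / dot ν ν) * ν i := by
  simp only [yprime, pperp]
  ring

/-- **Proposition 7.** Condition 1 holds when (i) `B = branch(R_A, TREE^λ(y))` and
`ν = ν_sib` for siblings `R_A, R_B` in `TREE^λ(y)`, and when (ii) `B` is any
permutation of `branch(R_A, TREE^λ(y))` and `ν = ν_reg` for `R_A ∈ TREE^λ(y)`. -/
theorem condition1_holds {n p : ℕ} (X : Fin n → Fin p → ℝ) (lam : ℝ)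
    (hlam : 0 ≤ lam) (y : Fin n → ℝ) (A B : Region p) :
    (SiblingsIn X (treeSet X lam y) A B →
      Condition1 X y (nuSib X A B) ((cart X lam y).branchTo A)) ∧
    (A ∈ treeSet X lam y →
      ∀ π : Equiv.Perm (Fin ((cart X lam y).branchTo A).length),
        Condition1 X y (nuReg X A) (permBranch ((cart X lam y).branchTo A) π)) := by
  refine ⟨fun h => ?_, fun hA π φ => ?_⟩
  · have hA : A ∈ treeSet X lam y := by
      obtain ⟨-, -, -, -, -, hA, -⟩ := h
      exact hA
    intro φ
    refine ⟨(φ / dot (nuSib X A B) (nuSib X A B) -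
        dot (nuSib X A B) y / dot (nuSib X A B) (nuSib X A B)) / (obs X A).card,
      -(φ / dot (nuSib X A B) (nuSib X A B) -
        dot (nuSib X A B) y / dot (nuSib X A B) (nuSib X A B)) / (obs X B).card, fun i => ?_⟩
    rw [yprime_apply, branchRegion_branchTo X lam y hA, lastSibRegion_branchTo X lam y h]
    generalize φ / dot (nuSib X A B) (nuSib X A B) -
        dot (nuSib X A B) y / dot (nuSib X A B) (nuSib X A B) = k
    simp only [nuSib]
    ring
  · refine ⟨(φ / dot (nuReg X A) (nuReg X A) -
        dot (nuReg X A) y / dot (nuReg X A) (nuReg X A)) / (obs X A).card, 0, fun i => ?_⟩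
    rw [yprime_apply, branchRegion_length_congr X (permBranch_perm _ π),
      branchRegion_branchTo X lam y hA]
    generalize φ / dot (nuReg X A) (nuReg X A) -
        dot (nuReg X A) y / dot (nuReg X A) (nuReg X A) = k
    simp only [nuReg]
    ring

end TreeValues
end
end
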